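/- The Hibi algebra H_{D(N)} over the distributive lattice D(N) is isomorphic as a ℂ-algebra to the semigroup ring ℂ[P(N_{k,2n})], i.e., to the monoid algebra over ℂ of the additive monoid of all order-preserving maps Ϝ_{k,2n} → ℤ_{≥0}. -/

import Mathlib

noncomputable section

/-- One-line tableau predicate: `isTab n m I J` says `[I:J]` is a one-line tableau in `D(n,m)`,
i.e. `I ⊆ {1,…,n}` and `J ⊆ {1,…,m}` are strictly increasing sequences of the same (positive) length. -/
def isTab (n m : ℕ) (I J : List ℕ) : Prop :=
  I.length = J.length ∧ I ≠ [] ∧ I.Chain' (· < ·) ∧ J.Chain' (· < ·) ∧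
    (∀ x ∈ I, 1 ≤ x ∧ x ≤ n) ∧ ∀ x ∈ J, 1 ≤ x ∧ x ≤ m

/-- The tableau order `A ⪯ B` on one-line tableaux. -/
def tleq (A B : List ℕ × List ℕ) : Prop :=
  B.1.length ≤ A.1.length ∧
    ∀ r < B.1.length, A.1.getD r 0 ≤ B.1.getD r 0 ∧ A.2.getD r 0 ≤ B.2.getD r 0

/-- The map ξ : `ξ([I:J]) = [j₁,…,jₕ, m+u₁,…,m+u_{n−h}]` where
`{n+1−u₁,…,n+1−u_{n−h}}` is the complement of `I` in `{1,…,n}`. -/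
def xi (n m : ℕ) (I J : List ℕ) : List ℕ :=
  J ++ ((((List.range n).map (· + 1)).filter fun c => decide (c ∉ I)).reverse.map
      fun c => m + (n + 1 - c))

/-- The top element `[m+1, …, m+n]`. -/
def topL (n m : ℕ) : List ℕ := (List.range n).map fun r => m + r + 1

def xiInvI (n m : ℕ) (K : List ℕ) : List ℕ :=
  ((List.range n).map (· + 1)).filter fun i => decide (m + (n + 1 - i) ∉ K)

def xiInvJ (m : ℕ) (K : List ℕ) : List ℕ := K.filter fun x => decide (x ≤ m)

/-- The meet `A ∧ B` in the distributive lattice `D(n,m)`, computed by transporting the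
entrywise minimum through the order isomorphism ξ. -/
def tabMeet (n m : ℕ) (A B : List ℕ × List ℕ) : List ℕ × List ℕ :=
  (xiInvI n m (List.zipWith min (xi n m A.1 A.2) (xi n m B.1 B.2)),
    xiInvJ m (List.zipWith min (xi n m A.1 A.2) (xi n m B.1 B.2)))

/-- The join `A ∨ B` in the distributive lattice `D(n,m)`. -/
def tabJoin (n m : ℕ) (A B : List ℕ × List ℕ) : List ℕ × List ℕ :=
  (xiInvI n m (List.zipWith max (xi n m A.1 A.2) (xi n m B.1 B.2)),
    xiInvJ m (List.zipWith max (xi n m A.1 A.2) (xi n m B.1 B.2)))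

/-- `inGT m (i,j)` : `z_j^{(i)}` is a point of the Gelfand–Tsetlin poset Γ_m. -/
def inGT (m : ℕ) (z : ℕ × ℕ) : Prop := 1 ≤ z.2 ∧ z.2 ≤ z.1 ∧ z.1 ≤ m

/-- The Gelfand–Tsetlin order: `gtLE (a,b) (i,j)` means `z_b^{(a)} ≤ z_j^{(i)}` in the partial
order generated by `z_j^{(i+1)} ≥ z_j^{(i)} ≥ z_{j+1}^{(i+1)}`. -/
def gtLE (z w : ℕ × ℕ) : Prop := w.2 ≤ z.2 ∧ z.1 + w.2 ≤ w.1 + z.2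

/-- `Jtilde n J` means `J ⪰ J̃ = [1,3,…,2n−1]`, i.e. `ℓ(J) ≤ n` and the `r`-th entry of `J`
is at least `2r−1` (0-based: entry at index r is ≥ 2r+1). -/
def Jtilde (n : ℕ) (J : List ℕ) : Prop :=
  J.length ≤ n ∧ ∀ r < J.length, 2 * r + 1 ≤ J.getD r 0

/-- `D(𝒩)` : one-line tableaux `[I:J] ∈ D(k,2n)` with `ℓ([I:J]) ≤ min(k,n)` and `J ⪰ J̃`. -/
def isTabN (k n : ℕ) (I J : List ℕ) : Prop :=
  isTab k (2 * n) I J ∧ I.length ≤ min k n ∧ Jtilde n J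

open Classical in
/-- The variable `z_t` of the Hibi algebra when `t` belongs to the lattice, else `0`. -/
def hVar (P : List ℕ × List ℕ → Prop) (t : List ℕ × List ℕ) : MvPolynomial {s // P s} ℂ :=
  if h : P t then MvPolynomial.X ⟨t, h⟩ else 0

/-- The Hibi ideal `(z_x z_y − z_{x∧y} z_{x∨y})` for the lattice `{s // P s}` with meet `mt`
and join `jn`; the Hibi algebra over the lattice is the corresponding quotient. -/
def hibiIdeal (P : List ℕ × List ℕ → Prop)
    (mt jn : List ℕ × List ℕ → List ℕ × List ℕ → List ℕ × List ℕ) :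
    Ideal (MvPolynomial {s // P s} ℂ) :=
  Ideal.span {f | ∃ x y : {s // P s},
    f = MvPolynomial.X x * MvPolynomial.X y - hVar P (mt x.1 y.1) * hVar P (jn x.1 y.1)}

/-- The poset `Γ_{n,m} = Γ_{m+n}^n \\ {z : z ≥ z_n^{(m+n)}}`. -/
def GammaSet (n m : ℕ) : Set (ℕ × ℕ) :=
  {z | inGT (m + n) z ∧ z.2 ≤ n ∧ ¬ gtLE (m + n, n) z}

/-- The poset `Ϝ_{k,2n} = Γ_{k,2n} \\ (A ∪ B)`. -/
def Fset (k n : ℕ) : Set (ℕ × ℕ) :=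
  {z | z ∈ GammaSet k (2 * n) ∧ ¬ (z.1 ≤ 2 * n ∧ z.1 + 1 < 2 * z.2) ∧
    ¬ gtLE z (2 * n, min k n + 1)}

/-- The additive monoid of order preserving maps `S → ℤ_{≥0}` (extended by 0 off `S`),
where `S` carries the GT order. -/
def coneMonoid (S : Set (ℕ × ℕ)) : AddSubmonoid ((ℕ × ℕ) → ℕ) where
  carrier := {q | (∀ z ∉ S, q z = 0) ∧ ∀ z w, z ∈ S → w ∈ S → gtLE z w → q z ≤ q w}
  zero_mem' := ⟨fun _ _ => rfl, fun _ _ _ _ _ => le_refl _⟩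
  add_mem' := by
    rintro a b ⟨ha0, ha1⟩ ⟨hb0, hb1⟩
    refine ⟨fun z hz => ?_, fun z w hz hw h => ?_⟩
    · simp [Pi.add_apply, ha0 z hz, hb0 z hz]
    · exact add_le_add (ha1 z w hz hw h) (hb1 z w hz hw h)

/-- The quotient of a polynomial ring by an ideal of relations that are exactly those holding
among the generators `φ i` of a commutative monoid is the algebra of this monoid. -/
theorem nonempty_quotient_algEquiv_addMonoidAlgebra {R ι M : Type*} [CommRing R] [AddCommMonoid M]
    (I : Ideal (MvPolynomial ι R)) (φ : ι → M)
    (hI : ∀ f ∈ I, MvPolynomial.aeval (fun i => AddMonoidAlgebra.single (φ i) (1 : R)) f = 0)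
    (hgen : ∀ q, ∃ s : Multiset ι, (s.map φ).sum = q)
    (hcong : ∀ s t : Multiset ι, (s.map φ).sum = (t.map φ).sum →
      (s.map fun i => Ideal.Quotient.mk I (MvPolynomial.X i)).prod =
        (t.map fun i => Ideal.Quotient.mk I (MvPolynomial.X i)).prod) :
    Nonempty ((MvPolynomial ι R ⧸ I) ≃ₐ[R] AddMonoidAlgebra R M) := by
  choose g hg using hgen
  let ψ : Multiplicative M →* MvPolynomial ι R ⧸ I :=
    { toFun := fun q => ((g q.toAdd).map fun i => Ideal.Quotient.mk I (MvPolynomial.X i)).prod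
      map_one' := by
        rw [hcong _ 0 (by simp [hg])]
        simp
      map_mul' := fun p q => by
        rw [← Multiset.prod_add, ← Multiset.map_add]
        exact hcong _ _ (by simp [hg]) }
  have hX : ∀ i, Ideal.Quotient.liftₐ I _ hI (Ideal.Quotient.mk I (MvPolynomial.X i)) =
      AddMonoidAlgebra.single (φ i) 1 :=
    fun i => MvPolynomial.aeval_X _ i
  refine ⟨AlgEquiv.ofAlgHom (Ideal.Quotient.liftₐ I _ hI) (AddMonoidAlgebra.lift R _ M ψ) ?_ ?_⟩
  · refine AddMonoidAlgebra.algHom_ext (fun q => ?_) (AlgHom.ext fun r => AlgHom.commutes _ r)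
    have key : ∀ s : Multiset ι, Ideal.Quotient.liftₐ I _ hI
        (s.map fun i => Ideal.Quotient.mk I (MvPolynomial.X i)).prod =
          AddMonoidAlgebra.single (s.map φ).sum 1 := by
      intro s
      induction s using Multiset.induction with
      | empty => simp [AddMonoidAlgebra.one_def]
      | cons i s ih =>
        rw [Multiset.map_cons, Multiset.prod_cons, map_mul, ih, hX]
        simp
    simpa [ψ, hg] using key (g q)
  · refine Ideal.Quotient.algHom_ext R (MvPolynomial.algHom_ext fun i => ?_)
    have h := hcong (g (φ i)) {i} (by simp [hg])
    change AddMonoidAlgebra.lift R _ M ψ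
      (Ideal.Quotient.liftₐ I _ hI (Ideal.Quotient.mk I (MvPolynomial.X i))) = _
    rw [hX i]
    simpa [ψ] using h

section Straightening

variable {ι α H : Type*} [CommMonoid H] {x : ι → H} {φ : ι → α → ℕ}

/-- A nonempty product of generators can be rewritten so that one factor has the same support as
the whole product. -/
theorem exists_straightened_factor
    (hx : ∀ i j, ∃ u v, φ u = φ i ⊔ φ j ∧ φ v = φ i ⊓ φ j ∧ x i * x j = x u * x v)
    (i : ι) (s : Multiset ι) :
    ∃ (u : ι) (t : Multiset ι), x i * (s.map x).prod = x u * (t.map x).prod ∧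
      φ i + (s.map φ).sum = φ u + (t.map φ).sum ∧
      ∀ z, φ u z = 0 → (φ i + (s.map φ).sum) z = 0 := by
  induction s using Multiset.induction generalizing i with
  | empty => exact ⟨i, 0, rfl, rfl, by simp⟩
  | cons j s ih =>
    obtain ⟨w, t, hprod, hsum, hsupp⟩ := ih j
    obtain ⟨u, v, hu, hv, huv⟩ := hx i w
    have hadd : φ i + φ w = φ u + φ v := by
      rw [hu, hv]
      exact funext fun z => (max_add_min _ _).symm
    refine ⟨u, v ::ₘ t, ?_, ?_, fun z hz => ?_⟩
    · simp only [Multiset.map_cons, Multiset.prod_cons]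
      rw [hprod, ← mul_assoc, huv, mul_assoc]
    · simp only [Multiset.map_cons, Multiset.sum_cons]
      rw [hsum, ← add_assoc, hadd, add_assoc]
    · have h : max (φ i z) (φ w z) = 0 := by simpa [hu] using hz
      have h₁ := hsupp z (by omega)
      simp only [Multiset.map_cons, Multiset.sum_cons]
      rw [Pi.add_apply, h₁]
      omega

/-- If the exponents of the generators are distinct `0`-`1` vectors closed under `⊔` and `⊓`, and
the generators satisfy the Hibi relations, then equal exponents give equal monomials. -/
theorem prod_map_eq_of_sum_map_eq (hle : ∀ i z, φ i z ≤ 1) (hinj : Function.Injective φ)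
    (hx : ∀ i j, ∃ u v, φ u = φ i ⊔ φ j ∧ φ v = φ i ⊓ φ j ∧ x i * x j = x u * x v)
    (top : α) (htop : ∀ i, φ i top = 1) {s t : Multiset ι}
    (h : (s.map φ).sum = (t.map φ).sum) :
    (s.map x).prod = (t.map x).prod := by
  have hcard : ∀ r : Multiset ι, (r.map φ).sum top = r.card := by
    intro r
    induction r using Multiset.induction with
    | empty => rfl
    | cons i r ih => simp [htop, ih, add_comm]
  induction hN : s.card generalizing s t with
  | zero =>
    have ht : t.card = 0 := by rw [← hcard, ← h, hcard, hN]
    rw [Multiset.card_eq_zero.1 hN, Multiset.card_eq_zero.1 ht]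
  | succ N ih =>
    have ht : t.card = N + 1 := by rw [← hcard, ← h, hcard, hN]
    obtain ⟨i, s, rfl⟩ := Multiset.card_pos_iff_exists_mem.1 (by omega : 0 < s.card) |>.imp
      fun i hi => Multiset.exists_cons_of_mem hi
    obtain ⟨j, t, rfl⟩ := Multiset.card_pos_iff_exists_mem.1 (by omega : 0 < t.card) |>.imp
      fun i hi => Multiset.exists_cons_of_mem hi
    obtain ⟨u, s', hs, hs₁, hs₂⟩ := exists_straightened_factor hx i s
    obtain ⟨v, t', ht, ht₁, ht₂⟩ := exists_straightened_factor hx j t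
    simp only [Multiset.map_cons, Multiset.sum_cons, Multiset.prod_cons] at h ⊢
    obtain rfl : u = v := by
      refine hinj (funext fun z => ?_)
      have e₁ := congrFun hs₁ z
      have e₂ := congrFun ht₁ z
      have e := congrFun h z
      have l₁ := hle u z
      have l₂ := hle v z
      have a₁ := hs₂ z
      have a₂ := ht₂ z
      simp only [Pi.add_apply] at e₁ e₂ e a₁ a₂
      omega
    have hsum : (s'.map φ).sum = (t'.map φ).sum := by
      rw [hs₁, ht₁] at h
      exact add_left_cancel h
    have hs' : s'.card = N := by
      have e := congrFun hs₁ top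
      simp only [Pi.add_apply, htop, hcard] at e
      simp only [Multiset.card_cons] at hN
      omega
    rw [hs, ht, ih hsum hs']

end Straightening

/-- The sequences `K` of the form `ξ([I:J])` with `[I:J] ∈ D(𝒩)`. -/
structure IsNullconeSeq (k n : ℕ) (K : List ℕ) : Prop where
  length_eq : K.length = k
  lt : ∀ i j, i < j → j < k → K.getD i 0 < K.getD j 0
  le : ∀ i < k, K.getD i 0 ≤ 2 * n + k
  ge : ∀ i < k, min (2 * i + 1) (n + i + 1) ≤ K.getD i 0
  head_le : K.getD 0 0 ≤ 2 * n

theorem add_sub_le_of_strictMono_below {g : ℕ → ℕ} {k : ℕ} (hg : ∀ i j, i < j → j < k → g i < g j)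
    {i j : ℕ} (hij : i ≤ j) (hj : j < k) : g i + (j - i) ≤ g j := by
  induction j, hij using Nat.le_induction with
  | base => simp
  | succ j hij ih =>
    have := ih (by omega)
    have := hg j (j + 1) (by omega) hj
    omega

theorem mem_Fset_iff {k n a b : ℕ} :
    (a, b) ∈ Fset k n ↔ 1 ≤ b ∧ b ≤ k ∧ a < 2 * n + b ∧ min (2 * b - 1) (n + b) ≤ a := by
  simp only [Fset, GammaSet, inGT, gtLE, Set.mem_ofPred_eq]
  omega

section Indicator

open Classical in
/-- The indicator function of the order filter of `Ϝ_{k,2n}` attached to the sequence `K`. -/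
def filterIndicator (k n : ℕ) (K : List ℕ) (z : ℕ × ℕ) : ℕ :=
  if z ∈ Fset k n ∧ K.getD (z.2 - 1) 0 ≤ z.1 then 1 else 0

variable {k n : ℕ} {K L : List ℕ}

theorem filterIndicator_le_one (z : ℕ × ℕ) : filterIndicator k n K z ≤ 1 := by
  unfold filterIndicator
  split_ifs <;> simp

theorem filterIndicator_top (hk : 0 < k) (hn : 0 < n) (hK : IsNullconeSeq k n K) :
    filterIndicator k n K (2 * n, 1) = 1 :=
  if_pos ⟨mem_Fset_iff.2 (by omega), by simpa using hK.head_le⟩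

theorem filterIndicator_mem_coneMonoid (hK : IsNullconeSeq k n K) :
    filterIndicator k n K ∈ coneMonoid (Fset k n) := by
  refine ⟨fun z hz => if_neg fun h => hz h.1, ?_⟩
  rintro ⟨a, b⟩ ⟨a', b'⟩ hz hw ⟨h₁, h₂⟩
  unfold filterIndicator
  split_ifs with hK₁ hK₂
  · exact le_rfl
  · refine absurd ⟨hw, ?_⟩ hK₂
    have h := hK₁.2
    rw [mem_Fset_iff] at hz hw
    have := add_sub_le_of_strictMono_below hK.lt (i := b' - 1) (j := b - 1) (by grind) (by omega)
    grind
  · simp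
  · simp

theorem IsNullconeSeq.le_add (hK : IsNullconeSeq k n K) {i : ℕ} (hi : i < k) :
    K.getD i 0 ≤ 2 * n + i + 1 := by
  have h₁ := add_sub_le_of_strictMono_below hK.lt (i := i) (j := k - 1) (by omega) (by omega)
  have h₂ := hK.le (k - 1) (by omega)
  omega

theorem filterIndicator_injective (hK : IsNullconeSeq k n K) (hL : IsNullconeSeq k n L)
    (h : filterIndicator k n K = filterIndicator k n L) : K = L := by
  have key : ∀ {K L : List ℕ}, IsNullconeSeq k n K → IsNullconeSeq k n L →
      filterIndicator k n K = filterIndicator k n L → ∀ i < k, K.getD i 0 ≤ L.getD i 0 := by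
    intro K L hK hL h i hi
    by_contra! hlt
    have h₁ := hK.le_add hi
    have hF : (L.getD i 0, i + 1) ∈ Fset k n := mem_Fset_iff.2 (by have := hL.ge i hi; omega)
    have e := congrFun h (L.getD i 0, i + 1)
    simp only [filterIndicator, hF, Nat.add_sub_cancel, le_refl, true_and, if_true] at e
    rw [if_neg (by omega)] at e
    exact zero_ne_one e
  refine List.ext_getElem (hK.length_eq.trans hL.length_eq.symm) fun i hi₁ hi₂ => ?_
  have hi : i < k := hK.length_eq ▸ hi₁
  have := le_antisymm (key hK hL h i hi) (key hL hK h.symm i hi)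
  simpa [hi₁, hi₂] using this

theorem getD_zipWith {f : ℕ → ℕ → ℕ} (hK : K.length = k) (hL : L.length = k) {i : ℕ} (hi : i < k) :
    (List.zipWith f K L).getD i 0 = f (K.getD i 0) (L.getD i 0) := by
  simp [hK, hL, hi]

theorem filterIndicator_zipWith_min (hK : IsNullconeSeq k n K) (hL : IsNullconeSeq k n L) :
    filterIndicator k n (List.zipWith min K L) =
      filterIndicator k n K ⊔ filterIndicator k n L := by
  funext ⟨a, b⟩
  simp only [filterIndicator, Pi.sup_apply]
  by_cases hF : (a, b) ∈ Fset k n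
  · rw [getD_zipWith hK.length_eq hL.length_eq (by rw [mem_Fset_iff] at hF; omega)]
    grind
  · simp [hF]

theorem filterIndicator_zipWith_max (hK : IsNullconeSeq k n K) (hL : IsNullconeSeq k n L) :
    filterIndicator k n (List.zipWith max K L) =
      filterIndicator k n K ⊓ filterIndicator k n L := by
  funext ⟨a, b⟩
  simp only [filterIndicator, Pi.inf_apply]
  by_cases hF : (a, b) ∈ Fset k n
  · rw [getD_zipWith hK.length_eq hL.length_eq (by rw [mem_Fset_iff] at hF; omega)]
    grind
  · simp [hF]

theorem IsNullconeSeq.zipWith {f : ℕ → ℕ → ℕ} (hf : ∀ a b, f a b = min a b ∨ f a b = max a b)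
    (hmono : ∀ a b c d, a < c → b < d → f a b < f c d)
    (hk : 0 < k) (hK : IsNullconeSeq k n K) (hL : IsNullconeSeq k n L) :
    IsNullconeSeq k n (List.zipWith f K L) := by
  have hget := fun {i} hi => getD_zipWith (f := f) hK.length_eq hL.length_eq (i := i) hi
  refine ⟨by simp [hK.length_eq, hL.length_eq], fun i j hij hj => ?_, fun i hi => ?_,
    fun i hi => ?_, ?_⟩
  · rw [hget hj, hget (hij.trans hj)]
    exact hmono _ _ _ _ (hK.lt i j hij hj) (hL.lt i j hij hj)
  · rw [hget hi]
    have := hf (K.getD i 0) (L.getD i 0)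
    have := hK.le i hi
    have := hL.le i hi
    omega
  · rw [hget hi]
    have := hf (K.getD i 0) (L.getD i 0)
    have := hK.ge i hi
    have := hL.ge i hi
    omega
  · rw [hget hk]
    have := hf (K.getD 0 0) (L.getD 0 0)
    have := hK.head_le
    have := hL.head_le
    omega

/-- The support of a nonzero order preserving map is the filter of some sequence. -/
theorem exists_filterIndicator_eq_support (hk : 0 < k) (hn : 0 < n) {q : ℕ × ℕ → ℕ}
    (hq : q ∈ coneMonoid (Fset k n)) (htop : q (2 * n, 1) ≠ 0) :
    ∃ K, IsNullconeSeq k n K ∧ ∀ z, filterIndicator k n K z = min 1 (q z) := by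
  classical
  obtain ⟨hq₀, hqm⟩ := hq
  have hex : ∀ b, ∃ a, ((a, b) ∈ Fset k n ∧ q (a, b) ≠ 0) ∨ a = 2 * n + b :=
    fun b => ⟨_, Or.inr rfl⟩
  choose g hg hmin using fun b =>
    (⟨_, Nat.find_spec (hex b), fun a ha => Nat.find_min' (hex b) ha⟩ :
      ∃ a, (((a, b) ∈ Fset k n ∧ q (a, b) ≠ 0) ∨ a = 2 * n + b) ∧
        ∀ a', (((a', b) ∈ Fset k n ∧ q (a', b) ≠ 0) ∨ a' = 2 * n + b) → a ≤ a')
  have hget : ∀ i < k, (List.ofFn fun i : Fin k => g (i + 1)).getD i 0 = g (i + 1) := by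
    intro i hi
    simp [hi]
  have hstep : ∀ b, 1 ≤ b → b < k → g b < g (b + 1) := by
    intro b hb hbk
    rcases hg (b + 1) with ⟨hF, hne⟩ | he
    · have hF' : (g (b + 1) - 1, b) ∈ Fset k n := by
        rw [mem_Fset_iff] at hF ⊢
        omega
      have hpos := hqm _ _ hF hF' ⟨by simp, by rw [mem_Fset_iff] at hF; grind⟩
      have := hmin b _ (Or.inl ⟨hF', by omega⟩)
      rw [mem_Fset_iff] at hF
      omega
    · have := hmin b _ (Or.inr rfl)
      omega
  have hlt : ∀ i j, i < j → j < k → g (i + 1) < g (j + 1) := by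
    intro i j hij hj
    induction j, hij using Nat.le_induction with
    | base => exact hstep _ (by omega) hj
    | succ j hij ih => exact (ih (by omega)).trans (hstep _ (by omega) hj)
  refine ⟨List.ofFn fun i : Fin k => g (i + 1),
    ⟨by simp, fun i j hij hj => ?_, fun i hi => ?_, fun i hi => ?_, ?_⟩, ?_⟩
  · rw [hget i (hij.trans hj), hget j hj]
    exact hlt i j hij hj
  · rw [hget i hi]
    have := hmin (i + 1) _ (Or.inr rfl)
    omega
  · rw [hget i hi]
    rcases hg (i + 1) with ⟨hF, -⟩ | he
    · rw [mem_Fset_iff] at hF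
      omega
    · omega
  · rw [hget 0 hk]
    exact hmin 1 _ (Or.inl ⟨mem_Fset_iff.2 (by omega), htop⟩)
  · rintro ⟨a, b⟩
    by_cases hF : (a, b) ∈ Fset k n
    · have hF' := mem_Fset_iff.1 hF
      have hb : b - 1 + 1 = b := by omega
      simp only [filterIndicator, hF, true_and]
      rw [hget (b - 1) (by omega), hb]
      by_cases hqz : q (a, b) = 0
      · rw [if_neg, hqz, min_eq_right zero_le_one]
        intro hle
        rcases hg b with ⟨hG, hne⟩ | he
        · have := hqm _ _ hG hF ⟨le_rfl, by simpa using hle⟩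
          omega
        · omega
      · rw [if_pos (hmin b a (Or.inl ⟨hF, hqz⟩))]
        omega
    · rw [hq₀ _ hF]
      exact if_neg fun h => hF h.1

/-- Every order preserving map is a sum of indicator functions of filters. -/
theorem exists_sum_filterIndicator (hk : 0 < k) (hn : 0 < n) {q : ℕ × ℕ → ℕ}
    (hq : q ∈ coneMonoid (Fset k n)) :
    ∃ s : Multiset {K // IsNullconeSeq k n K},
      (s.map fun K => filterIndicator k n K.1).sum = q := by
  induction hN : q (2 * n, 1) generalizing q with
  | zero =>
    refine ⟨0, funext fun z => ?_⟩
    by_cases hz : z ∈ Fset k n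
    · have htop : ((2 * n, 1) : ℕ × ℕ) ∈ Fset k n := mem_Fset_iff.2 (by omega)
      obtain ⟨a, b⟩ := z
      have := hq.2 _ _ hz htop (by rw [mem_Fset_iff] at hz; constructor <;> grind)
      simp only [Multiset.map_zero, Multiset.sum_zero, Pi.zero_apply]
      omega
    · simpa using (hq.1 z hz).symm
  | succ N ih =>
    obtain ⟨K, hK, hsupp⟩ := exists_filterIndicator_eq_support hk hn hq (by omega)
    have hq' : q - filterIndicator k n K ∈ coneMonoid (Fset k n) := by
      refine ⟨fun z hz => by simp [hq.1 z hz], fun z w hz hw hzw => ?_⟩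
      have := hq.2 z w hz hw hzw
      simp only [Pi.sub_apply, hsupp]
      omega
    obtain ⟨s, hs⟩ := ih hq' (by simp [hsupp, hN])
    refine ⟨⟨K, hK⟩ ::ₘ s, ?_⟩
    rw [Multiset.map_cons, Multiset.sum_cons, hs]
    funext z
    simp only [Pi.add_apply, Pi.sub_apply, hsupp]
    omega

end Indicator

section Tableaux

variable {k m n : ℕ} {I J K : List ℕ}

theorem sortedLT_map_succ_range (n : ℕ) : ((List.range n).map (· + 1)).SortedLT :=
  (List.pairwise_lt_range.map _ fun _ _ h => Nat.succ_lt_succ h).sortedLT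

theorem mem_map_succ_range {x : ℕ} : x ∈ (List.range n).map (· + 1) ↔ 1 ≤ x ∧ x ≤ n := by
  rw [List.mem_map]
  constructor
  · rintro ⟨a, ha, rfl⟩
    rw [List.mem_range] at ha
    omega
  · exact fun h => ⟨x - 1, List.mem_range.2 (by omega), by omega⟩

theorem mem_xi {x : ℕ} :
    x ∈ xi n m I J ↔ x ∈ J ∨ ∃ c, 1 ≤ c ∧ c ≤ n ∧ c ∉ I ∧ m + (n + 1 - c) = x := by
  simp only [xi, List.mem_append, List.mem_map (l := List.reverse _), List.mem_reverse,
    List.mem_filter, mem_map_succ_range, decide_eq_true_eq, and_assoc]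

theorem mem_xiInvI {x : ℕ} :
    x ∈ xiInvI n m K ↔ (1 ≤ x ∧ x ≤ n) ∧ m + (n + 1 - x) ∉ K := by
  simp only [xiInvI, List.mem_filter, mem_map_succ_range, decide_eq_true_eq]

theorem mem_xiInvJ {x : ℕ} : x ∈ xiInvJ m K ↔ x ∈ K ∧ x ≤ m := by
  simp [xiInvJ]

theorem sortedLT_xi (hJ : J.SortedLT) (hJm : ∀ x ∈ J, x ≤ m) : (xi n m I J).SortedLT := by
  refine List.Pairwise.sortedLT (List.pairwise_append.2 ⟨hJ.pairwise, ?_, ?_⟩)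
  · rw [List.pairwise_map, List.pairwise_reverse]
    refine List.Pairwise.imp_of_mem ?_ ((sortedLT_map_succ_range n).pairwise.filter _)
    intro a b ha hb hab
    have := mem_map_succ_range.1 (List.mem_filter.1 hb).1
    omega
  · intro x hx y hy
    rw [List.mem_map] at hy
    obtain ⟨c, hc, rfl⟩ := hy
    have := mem_map_succ_range.1 (List.mem_filter.1 (List.mem_reverse.1 hc)).1
    have := hJm x hx
    omega

theorem sortedLT_xiInvI : (xiInvI n m K).SortedLT :=
  ((sortedLT_map_succ_range n).pairwise.filter _).sortedLT

theorem sortedLT_xiInvJ (hK : K.SortedLT) : (xiInvJ m K).SortedLT :=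
  (hK.pairwise.filter _).sortedLT

theorem length_xi (hI : I.SortedLT) (hIn : ∀ x ∈ I, 1 ≤ x ∧ x ≤ n) :
    (xi n m I J).length + I.length = J.length + n := by
  have h : ((List.range n).map (· + 1)).filter (fun c => decide (c ∈ I)) = I := by
    refine List.SortedLT.eq_of_mem_iff
      ((sortedLT_map_succ_range n).pairwise.filter _).sortedLT hI fun x => ?_
    rw [List.mem_filter, mem_map_succ_range, decide_eq_true_eq]
    exact ⟨fun h => h.2, fun h => ⟨hIn x h, h⟩⟩
  have h' := List.length_eq_length_filter_add (l := (List.range n).map (· + 1))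
    (fun c => decide (c ∈ I))
  rw [h] at h'
  simp only [List.length_map, List.length_range] at h'
  simp only [xi, List.length_append, List.length_map, List.length_reverse, decide_not]
  omega

theorem xiInvI_xi (hI : I.SortedLT) (hIn : ∀ x ∈ I, 1 ≤ x ∧ x ≤ n) (hJm : ∀ x ∈ J, x ≤ m) :
    xiInvI n m (xi n m I J) = I := by
  refine sortedLT_xiInvI.eq_of_mem_iff hI fun x => ?_
  rw [mem_xiInvI, mem_xi]
  constructor
  · rintro ⟨hx, h⟩
    by_contra hxI
    exact h (Or.inr ⟨x, hx.1, hx.2, hxI, rfl⟩)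
  · refine fun hx => ⟨hIn x hx, ?_⟩
    have := hIn x hx
    rintro (h | ⟨c, h₁, h₂, hc, h⟩)
    · have := hJm _ h
      omega
    · obtain rfl : c = x := by omega
      exact hc hx

theorem xiInvJ_xi (hJ : J.SortedLT) (hJm : ∀ x ∈ J, x ≤ m) : xiInvJ m (xi n m I J) = J := by
  refine (sortedLT_xiInvJ (sortedLT_xi hJ hJm)).eq_of_mem_iff hJ fun x => ?_
  rw [mem_xiInvJ, mem_xi]
  constructor
  · rintro ⟨h | ⟨c, h₁, h₂, -, h⟩, hx⟩
    · exact h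
    · omega
  · exact fun h => ⟨Or.inl h, hJm x h⟩

theorem xi_xiInv (hK : K.SortedLT) (hKmn : ∀ x ∈ K, x ≤ m + n) :
    xi n m (xiInvI n m K) (xiInvJ m K) = K := by
  refine (sortedLT_xi (sortedLT_xiInvJ hK) fun x hx => (mem_xiInvJ.1 hx).2).eq_of_mem_iff hK
    fun x => ?_
  rw [mem_xi, mem_xiInvJ]
  simp only [mem_xiInvI]
  constructor
  · rintro (h | ⟨c, h₁, h₂, h, rfl⟩)
    · exact h.1
    · by_contra hc
      exact h ⟨⟨h₁, h₂⟩, hc⟩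
  · intro h
    have := hKmn x h
    by_cases hx : x ≤ m
    · exact Or.inl ⟨h, hx⟩
    · have e : m + (n + 1 - (m + n + 1 - x)) = x := by omega
      exact Or.inr ⟨m + n + 1 - x, by omega, by omega, by rw [e]; tauto, e⟩

theorem getD_xi_left {r : ℕ} (hr : r < J.length) : (xi n m I J).getD r 0 = J.getD r 0 := by
  simp [xi, hr, List.getElem?_append_left]

theorem List.SortedLT.getD_lt_getD {l : List ℕ} (hl : l.SortedLT) {i j : ℕ} (hij : i < j)
    (hj : j < l.length) : l.getD i 0 < l.getD j 0 := by
  simpa [hj, hij.trans hj] using hl.getElem_lt_getElem_of_lt (hi := hij.trans hj) (hj := hj) hij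

theorem List.getD_mem_of_lt {l : List ℕ} {i : ℕ} (hi : i < l.length) : l.getD i 0 ∈ l := by
  simp [hi]

theorem IsNullconeSeq.sortedLT (hK : IsNullconeSeq k n K) : K.SortedLT := by
  refine (List.pairwise_iff_getElem.2 fun i j hi hj hij => ?_).sortedLT
  simpa [hi, hj] using hK.lt i j hij (hK.length_eq ▸ hj)

theorem IsNullconeSeq.mem_le (hK : IsNullconeSeq k n K) {x : ℕ} (hx : x ∈ K) :
    1 ≤ x ∧ x ≤ 2 * n + k := by
  obtain ⟨i, hi, rfl⟩ := List.getElem_of_mem hx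
  have h₁ := hK.le i (hK.length_eq ▸ hi)
  have h₂ := hK.ge i (hK.length_eq ▸ hi)
  simp only [List.getD_eq_getElem _ _ hi] at h₁ h₂
  omega

theorem isTabN.sortedLT (h : isTabN k n I J) : I.SortedLT ∧ J.SortedLT := by
  obtain ⟨⟨-, -, hI, hJ, -, -⟩, -, -⟩ := h
  exact ⟨(List.isChain_iff_pairwise.1 hI).sortedLT, (List.isChain_iff_pairwise.1 hJ).sortedLT⟩

theorem isTabN.isNullconeSeq_xi (h : isTabN k n I J) :
    IsNullconeSeq k n (xi k (2 * n) I J) := by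
  obtain ⟨hI, hJ⟩ := h.sortedLT
  obtain ⟨⟨hlen, hne, -, -, hIk, hJn⟩, hlen_le, -, hJt⟩ := h
  have hsort := sortedLT_xi (n := k) (I := I) hJ fun x hx => (hJn x hx).2
  have hK : (xi k (2 * n) I J).length = k := by
    have := length_xi (m := 2 * n) (J := J) hI hIk
    omega
  have hlt : ∀ i j, i < j → j < k → (xi k (2 * n) I J).getD i 0 < (xi k (2 * n) I J).getD j 0 :=
    fun i j hij hj => hsort.getD_lt_getD hij (hK.symm ▸ hj)
  have hpos : 0 < J.length := hlen ▸ List.length_pos_iff.2 hne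
  refine ⟨hK, hlt, fun i hi => ?_, fun i hi => ?_, ?_⟩
  · rcases mem_xi.1 (List.getD_mem_of_lt (hK.symm ▸ hi)) with h | ⟨c, h₁, h₂, -, h⟩
    · have := hJn _ h
      omega
    · omega
  · by_cases hi' : i < J.length
    · rw [getD_xi_left hi']
      exact (min_le_left _ _).trans (hJt i hi')
    · have h₁ := add_sub_le_of_strictMono_below hlt (i := J.length) (by omega) hi
      have h₂ : 2 * n + 1 ≤ (xi k (2 * n) I J).getD J.length 0 := by
        have hlt' : J.length < (xi k (2 * n) I J).length := by omega
        have hmem : (xi k (2 * n) I J).getD J.length 0 ∈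
            (((List.range k).map (· + 1)).filter fun c => decide (c ∉ I)).reverse.map
              fun c => 2 * n + (k + 1 - c) := by
          have hdrop : (xi k (2 * n) I J).drop J.length = _ := List.drop_left
          rw [← hdrop, List.getD_eq_getElem _ _ hlt', List.mem_drop_iff_getElem]
          exact ⟨0, by omega, by simp⟩
        obtain ⟨c, hc, hc'⟩ := List.mem_map.1 hmem
        have := mem_map_succ_range.1 (List.mem_filter.1 (List.mem_reverse.1 hc)).1
        omega
      omega
  · rw [getD_xi_left hpos]
    exact (hJn _ (List.getD_mem_of_lt hpos)).2

theorem IsNullconeSeq.xi_xiInv (hK : IsNullconeSeq k n K) :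
    xi k (2 * n) (xiInvI k (2 * n) K) (xiInvJ (2 * n) K) = K :=
  _root_.xi_xiInv hK.sortedLT fun _ hx => (hK.mem_le hx).2

theorem IsNullconeSeq.isTabN (hk : 0 < k) (hK : IsNullconeSeq k n K) :
    isTabN k n (xiInvI k (2 * n) K) (xiInvJ (2 * n) K) := by
  have hIk : ∀ x ∈ xiInvI k (2 * n) K, 1 ≤ x ∧ x ≤ k := fun x hx => (mem_xiInvI.1 hx).1
  have hlen := length_xi (m := 2 * n) (J := xiInvJ (2 * n) K) sortedLT_xiInvI hIk
  rw [hK.xi_xiInv, hK.length_eq] at hlen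
  have hJk : (xiInvJ (2 * n) K).length ≤ k := hK.length_eq ▸ List.length_filter_le _ _
  have hget : ∀ r < (xiInvJ (2 * n) K).length,
      (xiInvJ (2 * n) K).getD r 0 = K.getD r 0 ∧ K.getD r 0 ≤ 2 * n := by
    intro r hr
    have e := getD_xi_left (n := k) (m := 2 * n) (I := xiInvI k (2 * n) K) hr
    rw [hK.xi_xiInv] at e
    exact ⟨e.symm, e ▸ (mem_xiInvJ.1 (List.getD_mem_of_lt hr)).2⟩
  have hr_lt : ∀ r < (xiInvJ (2 * n) K).length, r < n ∧ 2 * r + 1 ≤ K.getD r 0 := by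
    intro r hr
    have := (hget r hr).2
    have := hK.ge r (by omega)
    omega
  have hJn : (xiInvJ (2 * n) K).length ≤ n := by
    by_contra! hlt
    exact lt_irrefl n (hr_lt n hlt).1
  have hmem : K.getD 0 0 ∈ xiInvJ (2 * n) K :=
    mem_xiInvJ.2 ⟨List.getD_mem_of_lt (by rw [hK.length_eq]; exact hk), hK.head_le⟩
  have hpos : 0 < (xiInvJ (2 * n) K).length := List.length_pos_of_mem hmem
  refine ⟨⟨by omega, ?_, List.isChain_iff_pairwise.2 sortedLT_xiInvI.pairwise,
    List.isChain_iff_pairwise.2 (sortedLT_xiInvJ hK.sortedLT).pairwise, hIk, fun x hx => ?_⟩,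
    by omega, hJn, fun r hr => ?_⟩
  · exact List.length_pos_iff.1 (by omega)
  · obtain ⟨h₁, h₂⟩ := mem_xiInvJ.1 hx
    exact ⟨(hK.mem_le h₁).1, h₂⟩
  · rw [(hget r hr).1]
    exact (hr_lt r hr).2

theorem isTabN.xiInv_xi (h : isTabN k n I J) :
    xiInvI k (2 * n) (xi k (2 * n) I J) = I ∧ xiInvJ (2 * n) (xi k (2 * n) I J) = J := by
  obtain ⟨hI, hJ⟩ := h.sortedLT
  obtain ⟨⟨-, -, -, -, hIk, hJn⟩, -, -⟩ := h
  exact ⟨xiInvI_xi hI hIk fun x hx => (hJn x hx).2, xiInvJ_xi hJ fun x hx => (hJn x hx).2⟩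

end Tableaux

section HibiRelations

variable {k n : ℕ}

/-- The meet (resp. join) of two tableaux in `D(𝒩)` is a tableau in `D(𝒩)`, whose image under `ξ`
is the entrywise minimum (resp. maximum). -/
theorem isTabN_of_zipWith {f : ℕ → ℕ → ℕ} (hf : ∀ a b, f a b = min a b ∨ f a b = max a b)
    (hmono : ∀ a b c d, a < c → b < d → f a b < f c d) (hk : 0 < k)
    {A B : List ℕ × List ℕ} (hA : isTabN k n A.1 A.2) (hB : isTabN k n B.1 B.2)
    {K : List ℕ} (hK : K = List.zipWith f (xi k (2 * n) A.1 A.2) (xi k (2 * n) B.1 B.2)) :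
    isTabN k n (xiInvI k (2 * n) K) (xiInvJ (2 * n) K) ∧
      xi k (2 * n) (xiInvI k (2 * n) K) (xiInvJ (2 * n) K) = K := by
  have h : IsNullconeSeq k n K :=
    hK ▸ hA.isNullconeSeq_xi.zipWith hf hmono hk hB.isNullconeSeq_xi
  exact ⟨h.isTabN hk, h.xi_xiInv⟩

theorem exists_hibi_relation (hk : 0 < k) (i j : {s : List ℕ × List ℕ // isTabN k n s.1 s.2}) :
    ∃ u v : {s : List ℕ × List ℕ // isTabN k n s.1 s.2},
      u.1 = tabMeet k (2 * n) i.1 j.1 ∧ v.1 = tabJoin k (2 * n) i.1 j.1 ∧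
      filterIndicator k n (xi k (2 * n) u.1.1 u.1.2) =
        filterIndicator k n (xi k (2 * n) i.1.1 i.1.2) ⊔
          filterIndicator k n (xi k (2 * n) j.1.1 j.1.2) ∧
      filterIndicator k n (xi k (2 * n) v.1.1 v.1.2) =
        filterIndicator k n (xi k (2 * n) i.1.1 i.1.2) ⊓
          filterIndicator k n (xi k (2 * n) j.1.1 j.1.2) := by
  have hi := i.2.isNullconeSeq_xi
  have hj := j.2.isNullconeSeq_xi
  obtain ⟨hu, hu'⟩ := isTabN_of_zipWith (f := min) (by grind) (by grind) hk i.2 j.2 rfl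
  obtain ⟨hv, hv'⟩ := isTabN_of_zipWith (f := max) (by grind) (by grind) hk i.2 j.2 rfl
  refine ⟨⟨tabMeet k (2 * n) i.1 j.1, hu⟩, ⟨tabJoin k (2 * n) i.1 j.1, hv⟩, rfl, rfl, ?_, ?_⟩
  · rw [← filterIndicator_zipWith_min hi hj]
    exact congrArg _ hu'
  · rw [← filterIndicator_zipWith_max hi hj]
    exact congrArg _ hv'

end HibiRelations

/-- Proposition `cone4Sp` i. The Hibi algebra `H_{D(𝒩)}` is isomorphic
as a ℂ-algebra to the semigroup ring `ℂ[𝒫(𝒩_{k,2n})]`, i.e. to the monoid algebra of the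
additive monoid of order preserving maps `Ϝ_{k,2n} → ℤ_{≥0}`. -/
theorem hibi_isom_nullcone_semigroup_ring (k n : ℕ) (hk : 0 < k) (hn : 0 < n) :
    Nonempty ((MvPolynomial {s : List ℕ × List ℕ // isTabN k n s.1 s.2} ℂ ⧸
        hibiIdeal (fun s => isTabN k n s.1 s.2) (tabMeet k (2 * n)) (tabJoin k (2 * n)))
      ≃ₐ[ℂ] AddMonoidAlgebra ℂ (coneMonoid (Fset k n))) := by
  let φ : {s : List ℕ × List ℕ // isTabN k n s.1 s.2} → ℕ × ℕ → ℕ :=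
    fun s => filterIndicator k n (xi k (2 * n) s.1.1 s.1.2)
  let φ' : {s : List ℕ × List ℕ // isTabN k n s.1 s.2} → coneMonoid (Fset k n) :=
    fun s => ⟨φ s, filterIndicator_mem_coneMonoid s.2.isNullconeSeq_xi⟩
  have hφ' : ∀ s : Multiset _, ((s.map φ').sum : ℕ × ℕ → ℕ) = (s.map φ).sum := by
    intro s
    rw [AddSubmonoid.coe_multiset_sum, Multiset.map_map]
    rfl
  have hvar : ∀ s : {s : List ℕ × List ℕ // isTabN k n s.1 s.2},
      hVar (fun s => isTabN k n s.1 s.2) s.1 = MvPolynomial.X s :=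
    fun s => dif_pos s.2
  refine nonempty_quotient_algEquiv_addMonoidAlgebra _ φ' ?_ ?_ ?_
  · intro f hf
    rw [← RingHom.mem_ker]
    refine Ideal.span_le.2 ?_ hf
    rintro _ ⟨i, j, rfl⟩
    obtain ⟨u, v, hu, hv, hφu, hφv⟩ := exists_hibi_relation hk i j
    have hadd : φ' i + φ' j = φ' u + φ' v := by
      refine Subtype.ext (funext fun z => ?_)
      change φ i z + φ j z = φ u z + φ v z
      simp only [φ, hφu, hφv]
      exact (max_add_min _ _).symm
    rw [← hu, ← hv, hvar, hvar]
    simp [AddMonoidAlgebra.single_mul_single, hadd]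
  · rintro ⟨q, hq⟩
    obtain ⟨s, hs⟩ := exists_sum_filterIndicator hk hn hq
    refine ⟨s.map fun K => ⟨(xiInvI k (2 * n) K.1, xiInvJ (2 * n) K.1), K.2.isTabN hk⟩,
      Subtype.ext ?_⟩
    rw [hφ', Multiset.map_map]
    refine (congrArg _ (Multiset.map_congr rfl fun K _ => ?_)).trans hs
    exact congrArg (filterIndicator k n) K.2.xi_xiInv
  · intro s t hst
    refine prod_map_eq_of_sum_map_eq (φ := φ) (fun i z => filterIndicator_le_one z) ?_ ?_
      (2 * n, 1) (fun i => filterIndicator_top hk hn i.2.isNullconeSeq_xi) ?_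
    · intro i j hij
      have e := filterIndicator_injective i.2.isNullconeSeq_xi j.2.isNullconeSeq_xi hij
      refine Subtype.ext (Prod.ext ?_ ?_)
      · rw [← i.2.xiInv_xi.1, e, j.2.xiInv_xi.1]
      · rw [← i.2.xiInv_xi.2, e, j.2.xiInv_xi.2]
    · intro i j
      obtain ⟨u, v, hu, hv, hφu, hφv⟩ := exists_hibi_relation hk i j
      refine ⟨u, v, hφu, hφv, ?_⟩
      rw [← map_mul, ← map_mul, Ideal.Quotient.eq]
      refine Ideal.subset_span ⟨i, j, ?_⟩
      rw [← hu, ← hv, hvar, hvar]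
    · rw [← hφ', ← hφ', hst]

end
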